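/- For n ∈ ℤ∖{0} define T_n f(β) = in ∫_0^β L_{n,−}^{−1}f(b) db. There is a constant C = C(μ, δ, η), independent of n, such that for every n ∈ ℤ∖{0} and every f ∈ 𝒞^δ_0, T_n f ∈ 𝒞^δ and ‖T_n f‖_{𝒞^δ} ≤ C‖f‖_{𝒞^δ}. -/

import Mathlib

open Filter Topology Set MeasureTheory intervalIntegral

/-- sup norm over `[0,∞)`. -/
noncomputable def supN (f : ℝ → ℂ) : ℝ := ⨆ β : Ici (0 : ℝ), ‖f (β : ℝ)‖

/-- weighted seminorm `sup_{β>0} β^δ ‖f(β) − L‖`. -/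
noncomputable def hoel (δ : ℝ) (f : ℝ → ℂ) (L : ℂ) : ℝ :=
  ⨆ β : Ioi (0 : ℝ), (β : ℝ) ^ δ * ‖f (β : ℝ) - L‖

/-- the `𝒞^δ` norm, with `L = f(∞)`. -/
noncomputable def normC (δ : ℝ) (f : ℝ → ℂ) (L : ℂ) : ℝ := supN f + hoel δ f L

/-- membership in `𝒞^δ`, with limit value `L` at infinity. -/
def MemCdelta (δ : ℝ) (f : ℝ → ℂ) (L : ℂ) : Prop :=
  ContinuousOn f (Ici 0) ∧ Tendsto f atTop (nhds L) ∧
    BddAbove (Set.range fun β : Ioi (0 : ℝ) => (β : ℝ) ^ δ * ‖f (β : ℝ) - L‖)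

/-- `a_n(β) = √(n²μ² − (2μ−1)η(β))`. -/
noncomputable def aFun (μ : ℝ) (η : ℝ → ℝ) (n : ℤ) (β : ℝ) : ℝ :=
  Real.sqrt ((n : ℝ) ^ 2 * μ ^ 2 - (2 * μ - 1) * η β)

/-- `W_n(β) = exp(∫_1^β a_n(b)/b db)`. -/
noncomputable def WFun (μ : ℝ) (η : ℝ → ℝ) (n : ℤ) (β : ℝ) : ℝ :=
  Real.exp (∫ b in (1 : ℝ)..β, aFun μ η n b / b)

/-- `L_{n,-}^{-1}`. -/
noncomputable def Lminus (μ : ℝ) (η : ℝ → ℝ) (n : ℤ) (f : ℝ → ℂ) (β : ℝ) : ℂ :=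
  if 2 ≤ |n| then
    -(((β ^ (2 * μ - 1) / WFun μ η n β : ℝ) : ℂ) *
      ∫ b in (0 : ℝ)..β, ((b ^ (-(2 * μ)) * WFun μ η n b : ℝ) : ℂ) *
        Complex.exp (Complex.I * (n : ℂ) * ((β : ℂ) - (b : ℂ))) * f b)
  else
    ((β ^ (2 * μ - 1) / WFun μ η n β : ℝ) : ℂ) *
      ∫ b in Ioi β, ((b ^ (-(2 * μ)) * WFun μ η n b : ℝ) : ℂ) *
        Complex.exp (Complex.I * (n : ℂ) * ((β : ℂ) - (b : ℂ))) * f b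

/-- `T_n f (β) = in ∫_0^β L_{n,-}^{-1} f (b) db`. -/
noncomputable def Tn (μ : ℝ) (η : ℝ → ℝ) (n : ℤ) (f : ℝ → ℂ) (β : ℝ) : ℂ :=
  Complex.I * (n : ℂ) * ∫ b in (0 : ℝ)..β, Lminus μ η n f b

theorem integrableOn_Ioi_of_norm_le_rpow {g : ℝ → ℂ} {x B s : ℝ} (hx : 0 < x) (hs : 0 < s)
    (hg : ContinuousOn g (Ioi 0)) (hb : ∀ b, x < b → ‖g b‖ ≤ B * b ^ (-1 - s)) :
    IntegrableOn g (Ioi x) := by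
  refine ((integrableOn_Ioi_rpow_of_lt (by linarith : -1 - s < -1) hx).const_mul B).mono' ?_ ?_
  · exact (hg.mono (Ioi_subset_Ioi hx.le)).aestronglyMeasurable measurableSet_Ioi
  · exact (ae_restrict_iff' measurableSet_Ioi).2 (Eventually.of_forall fun b hxb => hb b hxb)

theorem norm_integral_Ioi_le_of_norm_le_rpow {g : ℝ → ℂ} {x B s : ℝ} (hx : 0 < x) (hs : 0 < s)
    (hb : ∀ b, x < b → ‖g b‖ ≤ B * b ^ (-1 - s)) :
    ‖∫ b in Ioi x, g b‖ ≤ B * (x ^ (-s) / s) := by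
  refine (norm_integral_le_of_norm_le
    ((integrableOn_Ioi_rpow_of_lt (by linarith : -1 - s < -1) hx).const_mul B)
    ((ae_restrict_iff' measurableSet_Ioi).2
      (Eventually.of_forall fun b hxb => hb b hxb))).trans ?_
  rw [MeasureTheory.integral_const_mul, integral_Ioi_rpow_of_lt (by linarith) hx,
    show -1 - s + 1 = -s by ring, neg_div_neg_eq]

theorem intervalIntegrable_zero_of_norm_le_rpow {g : ℝ → ℂ} {x B s : ℝ} (hx : 0 ≤ x)
    (hs : 0 < s) (hg : ContinuousOn g (Ioi 0))
    (hb : ∀ b, 0 < b → b ≤ x → ‖g b‖ ≤ B * b ^ (s - 1)) :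
    IntervalIntegrable g volume 0 x := by
  refine ((intervalIntegrable_rpow' (by linarith : -1 < s - 1)).const_mul B).mono_fun' ?_ ?_
  · rw [uIoc_of_le hx]
    exact (hg.mono Ioc_subset_Ioi_self).aestronglyMeasurable measurableSet_Ioc
  · rw [uIoc_of_le hx]
    exact (ae_restrict_iff' measurableSet_Ioc).2
      (Eventually.of_forall fun b h => hb b h.1 h.2)

theorem norm_integral_zero_le_of_norm_le_rpow {g : ℝ → ℂ} {x B s : ℝ} (hx : 0 ≤ x)
    (hs : 0 < s) (hb : ∀ b, 0 < b → b ≤ x → ‖g b‖ ≤ B * b ^ (s - 1)) :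
    ‖∫ b in (0 : ℝ)..x, g b‖ ≤ B * (x ^ s / s) := by
  refine (intervalIntegral.norm_integral_le_of_norm_le hx
    (Eventually.of_forall fun b h => hb b h.1 h.2)
    ((intervalIntegrable_rpow' (by linarith : -1 < s - 1)).const_mul B)).trans ?_
  rw [intervalIntegral.integral_const_mul, integral_rpow (Or.inl (by linarith)),
    sub_add_cancel, Real.zero_rpow hs.ne', sub_zero]

theorem hasDerivAt_integral_of_continuousOn_Ioi {g : ℝ → ℂ} {a x : ℝ} (hx : 0 < x)
    (hg : ContinuousOn g (Ioi 0)) (hi : IntervalIntegrable g volume a x) :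
    HasDerivAt (fun y => ∫ b in a..y, g b) (g x) x :=
  integral_hasDerivAt_right hi (hg.stronglyMeasurableAtFilter isOpen_Ioi x hx)
    (hg.continuousAt (Ioi_mem_nhds hx))

theorem intervalIntegrable_of_continuousOn_Ioi {E : Type*} [NormedAddCommGroup E] {g : ℝ → E}
    {x y : ℝ} (hx : 0 < x) (hy : 0 < y) (hg : ContinuousOn g (Ioi 0)) :
    IntervalIntegrable g volume x y :=
  (hg.mono fun _ hz => (lt_min hx hy).trans_le hz.1).intervalIntegrable

theorem hasDerivAt_integral_Ioi {g : ℝ → ℂ} {x : ℝ} (hx : 0 < x)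
    (hg : ContinuousOn g (Ioi 0)) (hi : ∀ y, 0 < y → IntegrableOn g (Ioi y)) :
    HasDerivAt (fun y => ∫ b in Ioi y, g b) (-g x) x := by
  have h := (hasDerivAt_integral_of_continuousOn_Ioi hx hg
    (intervalIntegrable_of_continuousOn_Ioi hx hx hg)).const_sub (∫ b in Ioi x, g b)
  refine h.congr_of_eventuallyEq ?_
  filter_upwards [Ioi_mem_nhds hx] with y hy
  rw [← integral_Ioi_sub_Ioi' (hi x hx) (hi y hy), sub_sub_cancel]

theorem memCdelta_primitive_of_ode {δ S H K M : ℝ} {ν : ℂ} {u f : ℝ → ℂ} {c : ℝ → ℝ}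
    (hδ : 0 < δ) (hS : 0 ≤ S) (hH : 0 ≤ H) (hK : 0 ≤ K) (hM : 0 ≤ M)
    (hc : ContinuousOn c (Ioi 0)) (hf : ContinuousOn f (Ioi 0))
    (hu : ∀ b, 0 < b → HasDerivAt u ((ν + (c b / b : ℝ)) * u b - f b / b) b)
    (huS : ∀ b, 0 < b → ‖ν‖ * ‖u b‖ ≤ K * S)
    (huH : ∀ b, 0 < b → ‖ν‖ * ‖u b‖ ≤ K * H * b ^ (-δ))
    (hcM : ∀ b, 0 < b → |c b| ≤ M * ‖ν‖) (hν : 1 ≤ ‖ν‖)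
    (hfH : ∀ b, 0 < b → ‖f b‖ ≤ H * b ^ (-δ)) :
    ∃ L : ℂ, MemCdelta δ (fun x => ν * ∫ b in (0 : ℝ)..x, u b) L ∧
      normC δ (fun x => ν * ∫ b in (0 : ℝ)..x, u b) L ≤
        (K + 3 * (K + (M * K + 1) / δ)) * (S + H) := by
  set T : ℝ → ℂ := fun x => ν * ∫ b in (0 : ℝ)..x, u b with hT
  set Q := K + (M * K + 1) / δ with hQ
  have hQ0 : 0 ≤ Q := by positivity
  have hν0 : 0 < ‖ν‖ := by linarith
  have hucont : ContinuousOn u (Ioi 0) := fun b hb =>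
    (hu b hb).continuousAt.continuousWithinAt
  have hub : ∀ b, 0 < b → ‖u b‖ ≤ K * S / ‖ν‖ * b ^ ((1 : ℝ) - 1) := fun b hb => by
    rw [sub_self, Real.rpow_zero, mul_one, le_div_iff₀ hν0, mul_comm]
    exact huS b hb
  have hui : ∀ x, 0 ≤ x → IntervalIntegrable u volume 0 x := fun x hx =>
    intervalIntegrable_zero_of_norm_le_rpow hx one_pos hucont fun b hb _ => hub b hb
  have hTsmall : ∀ x, 0 ≤ x → ‖T x‖ ≤ K * S * x := fun x hx => by
    have h := norm_integral_zero_le_of_norm_le_rpow hx one_pos fun b hb _ => hub b hb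
    rw [Real.rpow_one, div_one] at h
    calc ‖T x‖ = ‖ν‖ * ‖∫ b in (0 : ℝ)..x, u b‖ := norm_mul _ _
      _ ≤ ‖ν‖ * (K * S / ‖ν‖ * x) := by gcongr
      _ = K * S * x := by field_simp
  have hTderiv : ∀ x, 0 < x → HasDerivAt T (ν * u x) x := fun x hx =>
    (hasDerivAt_integral_of_continuousOn_Ioi hx hucont (hui x hx.le)).const_mul ν
  have hTcont : ContinuousOn T (Ici 0) := by
    intro x hx
    rcases (mem_Ici.1 hx).eq_or_lt with rfl | hx
    · have h0 : T 0 = 0 := by simp [hT]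
      rw [ContinuousWithinAt, h0]
      refine squeeze_zero_norm' (a := fun x => K * S * x)
        (eventually_mem_nhdsWithin.mono fun x hx => hTsmall x hx) ?_
      have : Tendsto (fun x : ℝ => K * S * x) (nhds 0) (nhds (K * S * 0)) :=
        tendsto_id.const_mul _
      rw [mul_zero] at this
      exact this.mono_left nhdsWithin_le_nhds
    · exact (hTderiv x hx).continuousAt.continuousWithinAt
  set g : ℝ → ℂ := fun b => f b / b - (c b / b : ℝ) * u b with hg
  have hinv : ContinuousOn (fun b : ℝ => (b : ℂ)) (Ioi 0) :=
    Complex.continuous_ofReal.continuousOn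
  have hne : ∀ b ∈ Ioi (0 : ℝ), (b : ℂ) ≠ 0 := fun b hb => by
    exact_mod_cast (ne_of_gt (mem_Ioi.1 hb))
  have hgcont : ContinuousOn g (Ioi 0) :=
    (hf.div hinv hne).sub ((Complex.continuous_ofReal.comp_continuousOn
      (hc.div continuousOn_id fun b hb => ne_of_gt hb)).mul hucont)
  have hgb : ∀ b, 0 < b → ‖g b‖ ≤ ((M * K + 1) * H) * b ^ (-1 - δ) := fun b hb => by
    have hpow : b ^ (-1 - δ) = b ^ (-δ) / b := by
      rw [show -1 - δ = -δ - 1 by ring, Real.rpow_sub_one hb.ne']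
    have h1 : ‖f b / b‖ ≤ H * b ^ (-δ) / b := by
      rw [norm_div, Complex.norm_real, Real.norm_of_nonneg hb.le]
      exact div_le_div_of_nonneg_right (hfH b hb) hb.le
    have h2 : ‖((c b / b : ℝ) : ℂ) * u b‖ ≤ M * (K * H * b ^ (-δ)) / b := by
      rw [norm_mul, Complex.norm_real, Real.norm_eq_abs, abs_div, abs_of_pos hb, div_mul_eq_mul_div]
      refine div_le_div_of_nonneg_right ?_ hb.le
      calc |c b| * ‖u b‖ ≤ M * ‖ν‖ * ‖u b‖ := by gcongr; exact hcM b hb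
        _ = M * (‖ν‖ * ‖u b‖) := by ring
        _ ≤ _ := mul_le_mul_of_nonneg_left (huH b hb) hM
    refine (norm_sub_le _ _).trans ((add_le_add h1 h2).trans (le_of_eq ?_))
    rw [hpow]; ring
  have hgi : ∀ x, 0 < x → IntegrableOn g (Ioi x) := fun x hx =>
    integrableOn_Ioi_of_norm_le_rpow hx hδ hgcont fun b hb => hgb b (hx.trans hb)
  set L : ℂ := T 1 - u 1 + ∫ b in Ioi (1 : ℝ), g b with hL
  have hTL : ∀ x, 0 < x → T x - L = u x - ∫ b in Ioi x, g b := fun x hx => by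
    have h := integral_eq_sub_of_hasDerivAt (a := 1) (b := x)
      (f := fun y => T y - u y) (f' := g) (fun y hy => by
        have hy : 0 < y := (lt_min one_pos hx).trans_le hy.1
        exact ((hTderiv y hy).sub (hu y hy)).congr_deriv (by simp only [hg]; ring)) (intervalIntegrable_of_continuousOn_Ioi one_pos hx hgcont)
    rw [← integral_Ioi_sub_Ioi' (hgi 1 one_pos) (hgi x hx)] at h
    rw [hL]
    linear_combination -h
  have hbound : ∀ x, 0 < x → ‖T x - L‖ ≤ Q * H * x ^ (-δ) := fun x hx => by
    have h1 : ‖u x‖ ≤ K * H * x ^ (-δ) :=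
      (le_mul_of_one_le_left (norm_nonneg _) hν).trans (huH x hx)
    have h2 := norm_integral_Ioi_le_of_norm_le_rpow hx hδ fun b hb => hgb b (hx.trans hb)
    rw [hTL x hx]
    refine (norm_sub_le _ _).trans ((add_le_add h1 h2).trans (le_of_eq ?_))
    rw [hQ]; ring
  have hweight : ∀ x, 0 < x → x ^ δ * ‖T x - L‖ ≤ Q * H := fun x hx => by
    calc x ^ δ * ‖T x - L‖ ≤ x ^ δ * (Q * H * x ^ (-δ)) := by gcongr; exact hbound x hx
      _ = Q * H * (x ^ δ * x ^ (-δ)) := by ring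
      _ = Q * H := by rw [← Real.rpow_add hx, add_neg_cancel, Real.rpow_zero, mul_one]
  have hbound' : ∀ x, 1 ≤ x → ‖T x - L‖ ≤ Q * H := fun x hx =>
    (hbound x (by linarith)).trans (mul_le_of_le_one_right (by positivity)
      (Real.rpow_le_one_of_one_le_of_nonpos hx (by linarith)))
  have hsup : ∀ x, 0 ≤ x → ‖T x‖ ≤ K * S + 2 * (Q * H) := fun x hx => by
    rcases le_total x 1 with h1 | h1
    · calc ‖T x‖ ≤ K * S * x := hTsmall x hx
        _ ≤ K * S := mul_le_of_le_one_right (by positivity) h1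
        _ ≤ _ := le_add_of_nonneg_right (by positivity)
    · have e : T x = (T x - L) - (T 1 - L) + T 1 := by ring
      have := hTsmall 1 zero_le_one
      have := hbound' x h1
      have := hbound' 1 le_rfl
      rw [e]
      refine (norm_add_le _ _).trans ?_
      linarith [norm_sub_le (T x - L) (T 1 - L)]
  refine ⟨L, ⟨hTcont, ?_, ⟨Q * H, ?_⟩⟩, ?_⟩
  · rw [tendsto_iff_norm_sub_tendsto_zero]
    refine squeeze_zero' (g := fun x => Q * H * x ^ (-δ))
      (Eventually.of_forall fun _ => norm_nonneg _)
      ((eventually_gt_atTop 0).mono hbound) ?_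
    simpa using (tendsto_rpow_neg_atTop hδ).const_mul (Q * H)
  · rintro _ ⟨x, rfl⟩
    exact hweight x x.2
  · have h1 : supN T ≤ K * S + 2 * (Q * H) := ciSup_le fun x : Ici (0 : ℝ) => hsup x x.2
    have h2 : hoel δ T L ≤ Q * H := ciSup_le fun x : Ioi (0 : ℝ) => hweight x x.2
    have h3 : 0 ≤ (K + 3 * Q) * (S + H) - (K * S + 3 * (Q * H)) := by
      have : (K + 3 * Q) * (S + H) - (K * S + 3 * (Q * H)) = K * H + 3 * (Q * S) := by ring
      rw [this]; positivity
    rw [normC]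
    linarith

section Weight

variable {μ : ℝ} {η : ℝ → ℝ} {n : ℤ}

theorem continuous_aFun (hη : Continuous η) : Continuous (aFun μ η n) :=
  (continuous_const.sub (continuous_const.mul hη)).sqrt

theorem hasDerivAt_integral_aFun (hη : Continuous η) {x : ℝ} (hx : 0 < x) :
    HasDerivAt (fun y => ∫ b in (1 : ℝ)..y, aFun μ η n b / b) (aFun μ η n x / x) x := by
  have hc : ContinuousOn (fun b => aFun μ η n b / b) (Ioi 0) :=
    (continuous_aFun hη).continuousOn.div continuousOn_id fun b hb => ne_of_gt hb
  exact integral_hasDerivAt_right (intervalIntegrable_of_continuousOn_Ioi one_pos hx hc)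
    (hc.stronglyMeasurableAtFilter isOpen_Ioi x hx) (hc.continuousAt (Ioi_mem_nhds hx))

theorem WFun_pos (x : ℝ) : 0 < WFun μ η n x := Real.exp_pos _

theorem hasDerivAt_WFun (hη : Continuous η) {x : ℝ} (hx : 0 < x) :
    HasDerivAt (WFun μ η n) (WFun μ η n x * (aFun μ η n x / x)) x :=
  (hasDerivAt_integral_aFun hη hx).exp

theorem hasDerivAt_WFun_mul_rpow (hη : Continuous η) {x : ℝ} (hx : 0 < x) (α : ℝ) :
    HasDerivAt (fun y => WFun μ η n y * y ^ (-α))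
      ((aFun μ η n x - α) * (WFun μ η n x * x ^ (-α) / x)) x := by
  refine ((hasDerivAt_WFun hη hx).mul
    (Real.hasDerivAt_rpow_const (p := -α) (Or.inl hx.ne'))).congr_deriv ?_
  rw [Real.rpow_sub_one hx.ne']; ring

theorem WFun_mul_rpow_monotoneOn (hη : Continuous η) {α : ℝ}
    (hα : ∀ x, α ≤ aFun μ η n x) :
    MonotoneOn (fun y => WFun μ η n y * y ^ (-α)) (Ioi 0) := by
  refine monotoneOn_of_deriv_nonneg (convex_Ioi 0)
    (fun x hx => (hasDerivAt_WFun_mul_rpow hη hx α).continuousAt.continuousWithinAt) ?_ ?_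
  · rw [interior_Ioi]
    exact fun x hx => (hasDerivAt_WFun_mul_rpow hη hx α).differentiableAt.differentiableWithinAt
  · rw [interior_Ioi]
    intro x hx
    have hx : 0 < x := hx
    rw [(hasDerivAt_WFun_mul_rpow hη hx α).deriv]
    have := WFun_pos (μ := μ) (η := η) (n := n) x
    exact mul_nonneg (sub_nonneg.2 (hα x)) (by positivity)

theorem WFun_mul_rpow_antitoneOn (hη : Continuous η) {α : ℝ}
    (hα : ∀ x, aFun μ η n x ≤ α) :
    AntitoneOn (fun y => WFun μ η n y * y ^ (-α)) (Ioi 0) := by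
  refine antitoneOn_of_deriv_nonpos (convex_Ioi 0)
    (fun x hx => (hasDerivAt_WFun_mul_rpow hη hx α).continuousAt.continuousWithinAt) ?_ ?_
  · rw [interior_Ioi]
    exact fun x hx => (hasDerivAt_WFun_mul_rpow hη hx α).differentiableAt.differentiableWithinAt
  · rw [interior_Ioi]
    intro x hx
    have hx : 0 < x := hx
    rw [(hasDerivAt_WFun_mul_rpow hη hx α).deriv]
    have := WFun_pos (μ := μ) (η := η) (n := n) x
    exact mul_nonpos_of_nonpos_of_nonneg (sub_nonpos.2 (hα x)) (by positivity)

/-- The source term in the integrating-factor representation of `Lminus`. -/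
noncomputable def weightedSource (μ : ℝ) (η : ℝ → ℝ) (n : ℤ) (f : ℝ → ℂ) (b : ℝ) : ℂ :=
  ((b ^ (-(2 * μ)) * WFun μ η n b : ℝ) : ℂ) * Complex.exp (-(Complex.I * n * b)) * f b

/-- The homogeneous solution in the integrating-factor representation of `Lminus`. -/
noncomputable def homogSolution (μ : ℝ) (η : ℝ → ℝ) (n : ℤ) (β : ℝ) : ℂ :=
  ((β ^ (2 * μ - 1) / WFun μ η n β : ℝ) : ℂ) * Complex.exp (Complex.I * n * β)

theorem norm_exp_I_mul_int_mul (n : ℤ) (x : ℝ) : ‖Complex.exp (Complex.I * n * x)‖ = 1 := by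
  rw [show Complex.I * n * x = ((n * x : ℝ) : ℂ) * Complex.I by push_cast; ring,
    Complex.norm_exp_ofReal_mul_I]

theorem norm_weightedSource {f : ℝ → ℂ} {b : ℝ} (hb : 0 < b) :
    ‖weightedSource μ η n f b‖ = b ^ (-(2 * μ)) * WFun μ η n b * ‖f b‖ := by
  have := WFun_pos (μ := μ) (η := η) (n := n) b
  rw [weightedSource, norm_mul, norm_mul, Complex.exp_neg, norm_inv, norm_exp_I_mul_int_mul,
    Complex.norm_real, Real.norm_of_nonneg (by positivity), inv_one, mul_one]

theorem norm_homogSolution {b : ℝ} (hb : 0 < b) :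
    ‖homogSolution μ η n b‖ = b ^ (2 * μ - 1) / WFun μ η n b := by
  have := WFun_pos (μ := μ) (η := η) (n := n) b
  rw [homogSolution, norm_mul, norm_exp_I_mul_int_mul,
    Complex.norm_real, Real.norm_of_nonneg (by positivity), mul_one]

theorem homogSolution_mul_weightedSource {f : ℝ → ℂ} {b : ℝ} (hb : 0 < b) :
    homogSolution μ η n b * weightedSource μ η n f b = f b / b := by
  have hW := (WFun_pos (μ := μ) (η := η) (n := n) b).ne'
  have h1 : b ^ (2 * μ - 1) / WFun μ η n b * (b ^ (-(2 * μ)) * WFun μ η n b) = b⁻¹ := by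
    rw [div_mul_eq_mul_div, div_eq_iff hW, ← mul_assoc, ← Real.rpow_add hb,
      show 2 * μ - 1 + -(2 * μ) = -1 by ring, Real.rpow_neg_one]
  calc homogSolution μ η n b * weightedSource μ η n f b
      = ((b ^ (2 * μ - 1) / WFun μ η n b * (b ^ (-(2 * μ)) * WFun μ η n b) : ℝ) : ℂ) *
        (Complex.exp (Complex.I * n * b) * Complex.exp (-(Complex.I * n * b))) * f b := by
        rw [homogSolution, weightedSource]; push_cast; ring
    _ = f b / b := by
        rw [h1, ← Complex.exp_add, add_neg_cancel, Complex.exp_zero]; push_cast; ring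

theorem continuousOn_weightedSource (hη : Continuous η) {f : ℝ → ℂ}
    (hf : ContinuousOn f (Ioi 0)) : ContinuousOn (weightedSource μ η n f) (Ioi 0) := by
  have hW : ContinuousOn (WFun μ η n) (Ioi 0) := fun x hx =>
    (hasDerivAt_WFun hη hx).continuousAt.continuousWithinAt
  have hp : ContinuousOn (fun b : ℝ => b ^ (-(2 * μ))) (Ioi 0) :=
    continuousOn_id.rpow_const fun b hb => Or.inl (ne_of_gt hb)
  refine ((Complex.continuous_ofReal.comp_continuousOn (hp.mul hW)).mul ?_).mul hf
  fun_prop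

theorem hasDerivAt_homogSolution (hη : Continuous η) {x : ℝ} (hx : 0 < x) :
    HasDerivAt (homogSolution μ η n)
      ((Complex.I * n + ((2 * μ - 1 - aFun μ η n x) / x : ℝ)) * homogSolution μ η n x) x := by
  have hW := (WFun_pos (μ := μ) (η := η) (n := n) x).ne'
  have h1 : HasDerivAt (fun y => y ^ (2 * μ - 1) / WFun μ η n y)
      ((2 * μ - 1 - aFun μ η n x) / x * (x ^ (2 * μ - 1) / WFun μ η n x)) x := by
    refine ((Real.hasDerivAt_rpow_const (p := 2 * μ - 1) (Or.inl hx.ne')).div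
      (hasDerivAt_WFun hη hx) hW).congr_deriv ?_
    rw [Real.rpow_sub_one hx.ne']
    field_simp
  have h2 : HasDerivAt (fun y : ℝ => Complex.exp (Complex.I * n * y))
      (Complex.exp (Complex.I * n * x) * (Complex.I * n * (1 : ℝ))) x :=
    ((hasDerivAt_id x).ofReal_comp.const_mul (Complex.I * n)).cexp
  refine (h1.ofReal_comp.mul h2).congr_deriv ?_
  rw [homogSolution]
  push_cast
  ring

theorem integrand_eq_exp_mul_weightedSource (f : ℝ → ℂ) (β b : ℝ) :
    ((b ^ (-(2 * μ)) * WFun μ η n b : ℝ) : ℂ) *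
        Complex.exp (Complex.I * (n : ℂ) * ((β : ℂ) - (b : ℂ))) * f b =
      Complex.exp (Complex.I * n * β) * weightedSource μ η n f b := by
  rw [weightedSource, mul_sub, sub_eq_add_neg, Complex.exp_add]
  ring

theorem Lminus_eq_of_two_le (hn : 2 ≤ |n|) (f : ℝ → ℂ) (β : ℝ) :
    Lminus μ η n f β =
      homogSolution μ η n β * -∫ b in (0 : ℝ)..β, weightedSource μ η n f b := by
  rw [Lminus, if_pos hn, homogSolution, mul_neg, mul_assoc]
  simp_rw [integrand_eq_exp_mul_weightedSource, intervalIntegral.integral_const_mul]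

theorem Lminus_eq_of_abs_lt_two (hn : ¬2 ≤ |n|) (f : ℝ → ℂ) (β : ℝ) :
    Lminus μ η n f β =
      homogSolution μ η n β * ∫ b in Ioi β, weightedSource μ η n f b := by
  rw [Lminus, if_neg hn, homogSolution, mul_assoc]
  simp_rw [integrand_eq_exp_mul_weightedSource, MeasureTheory.integral_const_mul]

theorem hasDerivAt_homogSolution_mul (hη : Continuous η) {f F : ℝ → ℂ} {x : ℝ} (hx : 0 < x)
    (hF : HasDerivAt F (-weightedSource μ η n f x) x) :
    HasDerivAt (fun y => homogSolution μ η n y * F y)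
      ((Complex.I * n + ((2 * μ - 1 - aFun μ η n x) / x : ℝ)) * (homogSolution μ η n x * F x) -
        f x / x) x := by
  refine ((hasDerivAt_homogSolution hη hx).mul hF).congr_deriv ?_
  rw [← homogSolution_mul_weightedSource (μ := μ) (η := η) (n := n) (f := f) hx]
  ring

theorem norm_weightedSource_le {f : ℝ → ℂ} {b W α B s : ℝ} (hb : 0 < b)
    (hW : WFun μ η n b * b ^ (-α) ≤ W) (hf : ‖f b‖ ≤ B * b ^ (-s)) :
    ‖weightedSource μ η n f b‖ ≤ W * B * b ^ (α - 2 * μ - s) := by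
  have hW0 := WFun_pos (μ := μ) (η := η) (n := n) b
  have h1 : b ^ (-(2 * μ)) = b ^ (-α) * b ^ (α - 2 * μ) := by
    rw [← Real.rpow_add hb]; ring_nf
  have h2 : b ^ (α - 2 * μ - s) = b ^ (α - 2 * μ) * b ^ (-s) := by
    rw [← Real.rpow_add hb]; ring_nf
  have hB : 0 ≤ B * b ^ (-s) := (norm_nonneg _).trans hf
  have hW1 : 0 ≤ W := le_trans (by positivity) hW
  rw [norm_weightedSource hb, h1, h2]
  calc b ^ (-α) * b ^ (α - 2 * μ) * WFun μ η n b * ‖f b‖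
      = (WFun μ η n b * b ^ (-α)) * b ^ (α - 2 * μ) * ‖f b‖ := by ring
    _ ≤ W * b ^ (α - 2 * μ) * (B * b ^ (-s)) := by gcongr
    _ = _ := by ring

theorem norm_homogSolution_mul_le {x α B s k : ℝ} {F : ℂ} (hx : 0 < x)
    (hF : ‖F‖ ≤ WFun μ η n x * x ^ (-α) * B * (x ^ (α - 2 * μ - s + 1) / k)) :
    ‖homogSolution μ η n x * F‖ ≤ B * x ^ (-s) / k := by
  have hW0 := WFun_pos (μ := μ) (η := η) (n := n) x
  rw [norm_mul, norm_homogSolution hx]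
  refine (mul_le_mul_of_nonneg_left hF (by positivity)).trans (le_of_eq ?_)
  have h : x ^ (-s) = x ^ (2 * μ - 1) * x ^ (-α) * x ^ (α - 2 * μ - s + 1) := by
    rw [← Real.rpow_add hx, ← Real.rpow_add hx]; ring_nf
  rw [h]
  field_simp

theorem norm_Lminus_le_of_two_le (hη : Continuous η) (hn : 2 ≤ |n|) {f : ℝ → ℂ}
    {α B s : ℝ} (hα : ∀ x, α ≤ aFun μ η n x) (hs : 0 < α - 2 * μ + 1 - s)
    (hf : ∀ b, 0 < b → ‖f b‖ ≤ B * b ^ (-s)) {x : ℝ} (hx : 0 < x) :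
    ‖Lminus μ η n f x‖ ≤ B * x ^ (-s) / (α - 2 * μ + 1 - s) := by
  have h := norm_integral_zero_le_of_norm_le_rpow hx.le hs fun b hb hbx =>
    (norm_weightedSource_le hb (WFun_mul_rpow_monotoneOn hη hα hb hx hbx) (hf b hb)).trans_eq
      (by rw [show α - 2 * μ - s = α - 2 * μ + 1 - s - 1 by ring])
  rw [Lminus_eq_of_two_le hn]
  refine norm_homogSolution_mul_le (α := α) hx ?_
  rw [norm_neg, show α - 2 * μ - s + 1 = α - 2 * μ + 1 - s by ring]
  exact h

theorem hasDerivAt_Lminus_of_two_le (hη : Continuous η) (hn : 2 ≤ |n|) {f : ℝ → ℂ}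
    (hfc : ContinuousOn f (Ioi 0)) {α B : ℝ} (hα : ∀ x, α ≤ aFun μ η n x)
    (hs : 0 < α - 2 * μ + 1) (hf : ∀ b, 0 < b → ‖f b‖ ≤ B) {x : ℝ} (hx : 0 < x) :
    HasDerivAt (Lminus μ η n f)
      ((Complex.I * n + ((2 * μ - 1 - aFun μ η n x) / x : ℝ)) * Lminus μ η n f x - f x / x)
      x := by
  have hi := intervalIntegrable_zero_of_norm_le_rpow hx.le hs
    (continuousOn_weightedSource (μ := μ) (n := n) hη hfc) fun b hb hbx =>
      (norm_weightedSource_le (s := 0) hb (WFun_mul_rpow_monotoneOn hη hα hb hx hbx)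
        (by simpa using hf b hb)).trans_eq
        (by rw [show α - 2 * μ - 0 = α - 2 * μ + 1 - 1 by ring])
  rw [funext (Lminus_eq_of_two_le hn f)]
  exact hasDerivAt_homogSolution_mul hη hx (hasDerivAt_integral_of_continuousOn_Ioi hx
    (continuousOn_weightedSource hη hfc) hi).neg

theorem norm_Lminus_le_of_abs_lt_two (hη : Continuous η) (hn : ¬2 ≤ |n|) {f : ℝ → ℂ}
    {α B s : ℝ} (hα : ∀ x, aFun μ η n x ≤ α) (hs : 0 < 2 * μ - 1 - α + s)
    (hf : ∀ b, 0 < b → ‖f b‖ ≤ B * b ^ (-s)) {x : ℝ} (hx : 0 < x) :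
    ‖Lminus μ η n f x‖ ≤ B * x ^ (-s) / (2 * μ - 1 - α + s) := by
  have h := norm_integral_Ioi_le_of_norm_le_rpow hx hs fun b hb =>
    (norm_weightedSource_le (hx.trans hb)
      (WFun_mul_rpow_antitoneOn hη hα hx (hx.trans hb) hb.le) (hf b (hx.trans hb))).trans_eq
      (by rw [show α - 2 * μ - s = -1 - (2 * μ - 1 - α + s) by ring])
  rw [Lminus_eq_of_abs_lt_two hn]
  refine norm_homogSolution_mul_le (α := α) hx ?_
  rw [show α - 2 * μ - s + 1 = -(2 * μ - 1 - α + s) by ring]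
  exact h

theorem hasDerivAt_Lminus_of_abs_lt_two (hη : Continuous η) (hn : ¬2 ≤ |n|) {f : ℝ → ℂ}
    (hfc : ContinuousOn f (Ioi 0)) {α B : ℝ} (hα : ∀ x, aFun μ η n x ≤ α)
    (hs : 0 < 2 * μ - 1 - α) (hf : ∀ b, 0 < b → ‖f b‖ ≤ B) {x : ℝ} (hx : 0 < x) :
    HasDerivAt (Lminus μ η n f)
      ((Complex.I * n + ((2 * μ - 1 - aFun μ η n x) / x : ℝ)) * Lminus μ η n f x - f x / x)
      x := by
  have hi : ∀ y, 0 < y → IntegrableOn (weightedSource μ η n f) (Ioi y) := fun y hy =>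
    integrableOn_Ioi_of_norm_le_rpow hy hs
      (continuousOn_weightedSource (μ := μ) (n := n) hη hfc) fun b hb =>
      (norm_weightedSource_le (s := 0) (hy.trans hb)
        (WFun_mul_rpow_antitoneOn hη hα hy (hy.trans hb) hb.le)
        (by simpa using hf b (hy.trans hb))).trans_eq
        (by rw [show α - 2 * μ - 0 = -1 - (2 * μ - 1 - α) by ring])
  rw [funext (Lminus_eq_of_abs_lt_two hn f)]
  exact hasDerivAt_homogSolution_mul hη hx
    (hasDerivAt_integral_Ioi hx (continuousOn_weightedSource hη hfc) hi)

theorem aFun_le (hμ : 1 < μ) (hη : ∀ β, 0 ≤ η β) (β : ℝ) :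
    aFun μ η n β ≤ |(n : ℝ)| * μ := by
  refine Real.sqrt_le_iff.2 ⟨by positivity, ?_⟩
  rw [mul_pow, sq_abs]
  have := mul_nonneg (by linarith : 0 ≤ 2 * μ - 1) (hη β)
  linarith

theorem half_abs_mul_sqrt_le_aFun (hμ : 1 < μ) (hη : ∀ β, η β ≤ 1) (hn : 2 ≤ |(n : ℝ)|)
    (β : ℝ) : |(n : ℝ)| / 2 * √(4 * μ ^ 2 - 2 * μ + 1) ≤ aFun μ η n β := by
  refine Real.le_sqrt_of_sq_le ?_
  rw [mul_pow, Real.sq_sqrt (by nlinarith), div_pow, sq_abs]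
  have h4 : 4 ≤ (n : ℝ) ^ 2 := by rw [← sq_abs]; nlinarith
  have h1 := mul_le_mul_of_nonneg_left (hη β) (by linarith : 0 ≤ 2 * μ - 1)
  nlinarith [mul_nonneg (sub_nonneg.2 h4) (by linarith : 0 ≤ 2 * μ - 1)]

theorem abs_int_mul_norm_Lminus_le (hμ : 1 < μ) (hη : Continuous η)
    (hη_range : ∀ β, 0 ≤ η β ∧ η β ≤ 1) (hn : n ≠ 0) {δ s B : ℝ} (hs : 0 ≤ s) (hsδ : s ≤ δ)
    (hδ : δ < √(4 * μ ^ 2 - 2 * μ + 1) - 2 * μ + 1) {f : ℝ → ℂ}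
    (hf : ∀ b, 0 < b → ‖f b‖ ≤ B * b ^ (-s)) {x : ℝ} (hx : 0 < x) :
    |(n : ℝ)| * ‖Lminus μ η n f x‖ ≤
      (2 / (√(4 * μ ^ 2 - 2 * μ + 1) - 2 * μ + 1 - δ) + 1 / (μ - 1)) * B * x ^ (-s) := by
  set r := √(4 * μ ^ 2 - 2 * μ + 1)
  have hB : 0 ≤ B * x ^ (-s) := (norm_nonneg _).trans (hf x hx)
  have hr : 0 < r - 2 * μ + 1 - δ := by linarith
  have hμ1 : 0 < μ - 1 := by linarith
  rw [mul_assoc, add_mul]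
  by_cases h2 : 2 ≤ |n|
  · have h2' : 2 ≤ |(n : ℝ)| := by exact_mod_cast h2
    have hk : |(n : ℝ)| / 2 * (r - 2 * μ + 1 - δ) ≤ |(n : ℝ)| / 2 * r - 2 * μ + 1 - s := by
      nlinarith
    have hk0 : 0 < |(n : ℝ)| / 2 * (r - 2 * μ + 1 - δ) := by positivity
    have h := norm_Lminus_le_of_two_le hη h2
      (half_abs_mul_sqrt_le_aFun hμ (fun β => (hη_range β).2) h2') (hk0.trans_le hk) hf hx
    calc |(n : ℝ)| * ‖Lminus μ η n f x‖
        ≤ |(n : ℝ)| * (B * x ^ (-s) / (|(n : ℝ)| / 2 * (r - 2 * μ + 1 - δ))) := by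
          gcongr
          exact h.trans (div_le_div_of_nonneg_left hB hk0 hk)
      _ = 2 / (r - 2 * μ + 1 - δ) * (B * x ^ (-s)) := by field_simp
      _ ≤ _ := le_add_of_nonneg_right (by positivity)
  · have h1 : |(n : ℝ)| = 1 := by
      have : |n| = 1 := by have := abs_pos.2 hn; omega
      exact_mod_cast this
    have h := norm_Lminus_le_of_abs_lt_two hη h2 (α := μ) (s := s)
      (fun β => (aFun_le hμ (fun β => (hη_range β).1) β).trans_eq (by rw [h1, one_mul]))
      (by linarith) hf hx
    rw [h1, one_mul]
    calc ‖Lminus μ η n f x‖ ≤ B * x ^ (-s) / (2 * μ - 1 - μ + s) := h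
      _ ≤ B * x ^ (-s) / (μ - 1) := div_le_div_of_nonneg_left hB hμ1 (by linarith)
      _ = 1 / (μ - 1) * (B * x ^ (-s)) := by ring
      _ ≤ _ := le_add_of_nonneg_left (by positivity)

theorem hasDerivAt_Lminus (hμ : 1 < μ) (hη : Continuous η)
    (hη_range : ∀ β, 0 ≤ η β ∧ η β ≤ 1) (hn : n ≠ 0)
    (hr : 0 < √(4 * μ ^ 2 - 2 * μ + 1) - 2 * μ + 1) {f : ℝ → ℂ} {B : ℝ}
    (hfc : ContinuousOn f (Ioi 0)) (hf : ∀ b, 0 < b → ‖f b‖ ≤ B) {x : ℝ} (hx : 0 < x) :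
    HasDerivAt (Lminus μ η n f)
      ((Complex.I * n + ((2 * μ - 1 - aFun μ η n x) / x : ℝ)) * Lminus μ η n f x - f x / x)
      x := by
  by_cases h2 : 2 ≤ |n|
  · have h2' : 2 ≤ |(n : ℝ)| := by exact_mod_cast h2
    exact hasDerivAt_Lminus_of_two_le hη h2 hfc
      (half_abs_mul_sqrt_le_aFun hμ (fun β => (hη_range β).2) h2') (by nlinarith) hf hx
  · have h1 : |(n : ℝ)| = 1 := by
      have : |n| = 1 := by have := abs_pos.2 hn; omega
      exact_mod_cast this
    exact hasDerivAt_Lminus_of_abs_lt_two hη h2 hfc (α := μ)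
      (fun β => (aFun_le hμ (fun β => (hη_range β).1) β).trans_eq (by rw [h1, one_mul]))
      (by linarith) hf hx

end Weight

theorem MemCdelta.norm_le_hoel_mul_rpow {δ : ℝ} {f : ℝ → ℂ} (hf : MemCdelta δ f 0) {b : ℝ}
    (hb : 0 < b) : ‖f b‖ ≤ hoel δ f 0 * b ^ (-δ) := by
  have h := le_ciSup hf.2.2 (⟨b, hb⟩ : Ioi (0 : ℝ))
  simp only [sub_zero] at h
  rw [Real.rpow_neg hb.le, ← div_eq_mul_inv, le_div_iff₀ (by positivity), mul_comm]
  simpa only [hoel, sub_zero] using h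

theorem MemCdelta.norm_le_supN {δ : ℝ} (hδ : 0 < δ) {f : ℝ → ℂ} (hf : MemCdelta δ f 0) {b : ℝ}
    (hb : 0 ≤ b) : ‖f b‖ ≤ supN f := by
  obtain ⟨M, hM⟩ := isCompact_Icc.exists_bound_of_continuousOn
    (hf.1.mono (Icc_subset_Ici_self : Icc (0 : ℝ) 1 ⊆ Ici 0))
  have hH : 0 ≤ hoel δ f 0 := Real.iSup_nonneg fun x : Ioi (0 : ℝ) =>
    mul_nonneg (Real.rpow_nonneg (le_of_lt x.2) _) (norm_nonneg _)
  refine le_ciSup (f := fun x : Ici (0 : ℝ) => ‖f x‖) ⟨max M (hoel δ f 0), ?_⟩ ⟨b, hb⟩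
  rintro _ ⟨⟨x, hx⟩, rfl⟩
  rcases le_total x 1 with h1 | h1
  · exact (hM x ⟨hx, h1⟩).trans (le_max_left _ _)
  · refine (hf.norm_le_hoel_mul_rpow (by linarith)).trans (le_trans ?_ (le_max_right _ _))
    exact mul_le_of_le_one_right hH (Real.rpow_le_one_of_one_le_of_nonpos h1 (by linarith))

/-- `T_n = (β∂_φ)(D_β+1)^{-1}L_{n,-}^{-1}` is bounded from `𝒞^δ_0`
to `𝒞^δ`, uniformly in `n ≠ 0`. -/
theorem stmt_15 (μ δ : ℝ) (hμ : 1 < μ)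
    (hδ0 : 0 < δ)
    (hδ1 : δ < min (Real.sqrt (4 * μ ^ 2 - 2 * μ + 1) - 2 * μ + 1) 1)
    (η : ℝ → ℝ) (hη_smooth : ContDiff ℝ (⊤ : ℕ∞) η)
    (hη_range : ∀ β, 0 ≤ η β ∧ η β ≤ 1)
    (hη0 : ∀ β : ℝ, β ≤ 1 → η β = 0) (hη1 : ∀ β : ℝ, 2 ≤ β → η β = 1) :
    ∃ C : ℝ, 0 < C ∧ ∀ n : ℤ, n ≠ 0 → ∀ f : ℝ → ℂ, MemCdelta δ f 0 →
      ∃ L : ℂ, MemCdelta δ (Tn μ η n f) L ∧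
        normC δ (Tn μ η n f) L ≤ C * normC δ f 0 := by
  obtain ⟨hδr, -⟩ := lt_min_iff.1 hδ1
  have hη := hη_smooth.continuous
  set K := 2 / (√(4 * μ ^ 2 - 2 * μ + 1) - 2 * μ + 1 - δ) + 1 / (μ - 1) with hK
  have hK0 : 0 < K := by
    have h1 : 0 < √(4 * μ ^ 2 - 2 * μ + 1) - 2 * μ + 1 - δ := by linarith
    have h2 : 0 < μ - 1 := by linarith
    positivity
  refine ⟨K + 3 * (K + (3 * μ * K + 1) / δ), by positivity, fun n hn f hf => ?_⟩
  have hfc : ContinuousOn f (Ioi 0) := hf.1.mono Ioi_subset_Ici_self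
  have hfS : ∀ b, 0 < b → ‖f b‖ ≤ supN f := fun b hb => hf.norm_le_supN hδ0 hb.le
  have hfH : ∀ b, 0 < b → ‖f b‖ ≤ hoel δ f 0 * b ^ (-δ) := fun b hb =>
    hf.norm_le_hoel_mul_rpow hb
  have hν : ‖Complex.I * (n : ℂ)‖ = |(n : ℝ)| := by
    rw [norm_mul, Complex.norm_I, one_mul, Complex.norm_intCast]
  have hn1 : 1 ≤ |(n : ℝ)| := by exact_mod_cast Int.one_le_abs hn
  refine memCdelta_primitive_of_ode (u := Lminus μ η n f)
    (c := fun b => 2 * μ - 1 - aFun μ η n b) (ν := Complex.I * n) (f := f) hδ0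
    ((norm_nonneg _).trans (hfS 1 one_pos)) ?_ hK0.le (by linarith)
    (continuous_const.sub (continuous_aFun hη)).continuousOn hfc
    (fun b hb => hasDerivAt_Lminus hμ hη hη_range hn (by linarith) hfc hfS hb)
    (fun b hb => ?_) (fun b hb => ?_) (fun b hb => ?_) (hn1.trans_eq hν.symm) hfH
  · simpa using (norm_nonneg _).trans (hfH 1 one_pos)
  · rw [hν]
    refine (abs_int_mul_norm_Lminus_le hμ hη hη_range hn le_rfl hδ0.le hδr
      (fun b hb => by simpa using hfS b hb) hb).trans_eq ?_
    rw [neg_zero, Real.rpow_zero, mul_one]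
  · rw [hν]
    exact abs_int_mul_norm_Lminus_le hμ hη hη_range hn hδ0.le le_rfl hδr hfH hb
  · rw [hν, abs_le]
    have h1 := aFun_le (n := n) hμ (fun β => (hη_range β).1) b
    have h2 : 0 ≤ aFun μ η n b := Real.sqrt_nonneg _
    constructor <;> nlinarith
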